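/- For every constant c ∈ ℝ, the function β(y) = (4/3)(c + log(1 + |y|²)) · (1 − |y|²)/(1 + |y|²) + (8/3)/(1 + |y|²) satisfies Δβ(y) + (8/(1 + |y|²)²) β(y) = (8/(1 + |y|²)²) · Y₀(y) for all y ∈ ℝ², where Y₀(y) = 2(1 − |y|²)/(1 + |y|²) and Δ denotes the Euclidean Laplacian Δf = ∂²f/∂y₁² + ∂²f/∂y₂². -/

import Mathlib

open Real

/-- Euclidean Laplacian on ℝ²: sum of second partial derivatives. -/
noncomputable def lap (f : EuclideanSpace ℝ (Fin 2) → ℝ) (x : EuclideanSpace ℝ (Fin 2)) : ℝ :=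
  ∑ i : Fin 2,
    fderiv ℝ (fun y => fderiv ℝ f y (EuclideanSpace.single i (1 : ℝ))) x
      (EuclideanSpace.single i (1 : ℝ))

/-- Y₀(y) = 2(1 − |y|²)/(1 + |y|²). -/
noncomputable def Y0 (y : EuclideanSpace ℝ (Fin 2)) : ℝ :=
  2 * (1 - ‖y‖ ^ 2) / (1 + ‖y‖ ^ 2)

/-- β(y) = (4/3)(c + log(1 + |y|²))(1 − |y|²)/(1 + |y|²) + (8/3)/(1 + |y|²). -/
noncomputable def betaFun (c : ℝ) (y : EuclideanSpace ℝ (Fin 2)) : ℝ :=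
  (4 / 3) * (c + Real.log (1 + ‖y‖ ^ 2)) * ((1 - ‖y‖ ^ 2) / (1 + ‖y‖ ^ 2)) +
    (8 / 3) / (1 + ‖y‖ ^ 2)

theorem hasFDerivAt_comp_norm_sq {E : Type*} [NormedAddCommGroup E] [InnerProductSpace ℝ E]
    {g : ℝ → ℝ} {g' : ℝ} {y : E} (hg : HasDerivAt g g' (‖y‖ ^ 2)) :
    HasFDerivAt (fun z => g (‖z‖ ^ 2)) (g' • 2 • innerSL ℝ y) y :=
  hg.comp_hasFDerivAt (f := fun z : E => ‖z‖ ^ 2) y (hasStrictFDerivAt_norm_sq y).hasFDerivAt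

theorem lap_comp_norm_sq {g g' : ℝ → ℝ} {g'' : ℝ} (y : EuclideanSpace ℝ (Fin 2))
    (hg : ∀ s, 0 ≤ s → HasDerivAt g (g' s) s) (hg' : HasDerivAt g' g'' (‖y‖ ^ 2)) :
    lap (fun z => g (‖z‖ ^ 2)) y = 4 * g' (‖y‖ ^ 2) + 4 * ‖y‖ ^ 2 * g'' := by
  have fderiv_apply_single (i : Fin 2) :
      (fun z : EuclideanSpace ℝ (Fin 2) =>
        fderiv ℝ (fun w => g (‖w‖ ^ 2)) z (EuclideanSpace.single i (1 : ℝ))) =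
      fun z => g' (‖z‖ ^ 2) * (2 * z i) := by
    funext z
    rw [(hasFDerivAt_comp_norm_sq (hg _ (sq_nonneg ‖z‖))).fderiv]
    simp [EuclideanSpace.inner_single_right]
  have fderiv_fderiv_apply_single (i : Fin 2) :
      fderiv ℝ (fun z : EuclideanSpace ℝ (Fin 2) => g' (‖z‖ ^ 2) * (2 * z i)) y
        (EuclideanSpace.single i (1 : ℝ)) = 2 * g' (‖y‖ ^ 2) + 4 * (y i) ^ 2 * g'' := by
    have coord : HasFDerivAt (fun z : EuclideanSpace ℝ (Fin 2) => 2 * z i)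
        ((2 : ℝ) • EuclideanSpace.proj (𝕜 := ℝ) i) y :=
      (EuclideanSpace.proj (𝕜 := ℝ) i).hasFDerivAt.const_mul 2
    rw [((hasFDerivAt_comp_norm_sq hg').fun_mul coord).fderiv]
    simp [EuclideanSpace.inner_single_right]
    ring
  simp only [lap, fderiv_apply_single, fderiv_fderiv_apply_single, Fin.sum_univ_two]
  rw [EuclideanSpace.real_norm_sq_eq, Fin.sum_univ_two]
  ring

theorem betaFun_equation (c : ℝ) :
    ∀ y : EuclideanSpace ℝ (Fin 2),
      lap (betaFun c) y + 8 / (1 + ‖y‖ ^ 2) ^ 2 * betaFun c y =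
        8 / (1 + ‖y‖ ^ 2) ^ 2 * Y0 y := by
  intro y
  have hasDerivAt_log {s : ℝ} (hs : 0 ≤ s) :
      HasDerivAt (fun s : ℝ => c + Real.log (1 + s)) (1 / (1 + s)) s :=
    (((hasDerivAt_id s).const_add 1).log (by simp; positivity)).const_add c
  have profile_deriv : ∀ s : ℝ, 0 ≤ s → HasDerivAt
      (fun s => (4 / 3) * (c + Real.log (1 + s)) * ((1 - s) / (1 + s)) + (8 / 3) / (1 + s))
      ((4 / 3) * (-1 / (1 + s) - 2 * (c + Real.log (1 + s)) / (1 + s) ^ 2)) s := by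
    intro s hs
    have hne : 1 + s ≠ 0 := by positivity
    have hden := (hasDerivAt_id' s).const_add 1
    refine ((((hasDerivAt_log hs).const_mul (4 / 3)).fun_mul
      (((hasDerivAt_id' s).const_sub 1).fun_div hden hne)).fun_add
      ((hasDerivAt_const s (8 / 3 : ℝ)).fun_div hden hne)).congr_deriv ?_
    field_simp
    ring
  have profile_second_deriv : ∀ s : ℝ, 0 ≤ s → HasDerivAt
      (fun s => (4 / 3) * (-1 / (1 + s) - 2 * (c + Real.log (1 + s)) / (1 + s) ^ 2))
      ((4 / 3) * (1 / (1 + s) ^ 2 - 2 / (1 + s) ^ 3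
        + 4 * (c + Real.log (1 + s)) / (1 + s) ^ 3)) s := by
    intro s hs
    have hne : 1 + s ≠ 0 := by positivity
    have hden := (hasDerivAt_id' s).const_add 1
    refine ((((hasDerivAt_const s (-1 : ℝ)).fun_div hden hne).fun_sub
      (((hasDerivAt_log hs).const_mul 2).fun_div (hden.fun_pow 2)
        (pow_ne_zero 2 hne))).const_mul (4 / 3)).congr_deriv ?_
    field_simp
    ring
  have hlap : lap (betaFun c) y = _ :=
    lap_comp_norm_sq y profile_deriv (profile_second_deriv _ (sq_nonneg ‖y‖))
  have hne : 1 + ‖y‖ ^ 2 ≠ 0 := by positivity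
  rw [hlap, betaFun, Y0]
  field_simp
  ring
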